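/- arXiv:2204.12462 — 2 statements merged into one kernel-verified Lean document; each statement's English description precedes it below -/
import Mathlib

section
/- Let (Θ, 𝒜, π) be a probability space, let p be a positive natural number, let r : Θ → EuclideanSpace ℝ (Fin p) be measurable and bounded, and let Q, Δ : Θ → ℝ be bounded measurable functions. For t ∈ ℝ set Q_t = Q + t·Δ and let E_t[·] denote expectation under the probability measure with density exp(−Q_t(θ)/2)/∫ exp(−Q_t/2) dπ with respect to π. Then the map t ↦ E_t[r] = (∫ exp(−Q_t(θ)/2) · r(θ) dπ(θ)) / (∫ exp(−Q_t(θ)/2) dπ(θ)) is differentiable at every t, with derivative equal to −(1/2)·(E_t[Δ·r] − E_t[Δ]·E_t[r]). -/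
open MeasureTheory

lemma qb_aux_bound (Q Δ MQ MΔ t x : ℝ) (hQ : |Q| ≤ MQ) (hΔ : |Δ| ≤ MΔ)
    (hx : x ∈ Metric.ball t 1) :
    Real.exp (-(Q + x * Δ) / 2) ≤ Real.exp ((MQ + (|t| + 1) * MΔ) / 2) := by
  apply Real.exp_le_exp.2
  have hx' : |x| ≤ |t| + 1 := by
    rw [Metric.mem_ball, Real.dist_eq] at hx
    have := abs_sub_abs_le_abs_sub x t
    linarith
  have h1 : |x * Δ| ≤ (|t| + 1) * MΔ := by
    rw [abs_mul]
    exact mul_le_mul hx' hΔ (abs_nonneg _) (by positivity)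
  have h2 := neg_abs_le (x * Δ)
  have h3 := neg_abs_le Q
  linarith

lemma qb_aux_deriv {Θ : Type*} [MeasurableSpace Θ] (π : Measure Θ) [IsProbabilityMeasure π]
    {E : Type*} [NormedAddCommGroup E] [NormedSpace ℝ E]
    (r : Θ → E) (hr : AEStronglyMeasurable r π)
    (Mr : ℝ) (hrbd : ∀ θ, ‖r θ‖ ≤ Mr)
    (Q Δ : Θ → ℝ) (hQmeas : Measurable Q) (hΔmeas : Measurable Δ)
    (MQ MΔ : ℝ) (hQbd : ∀ θ, |Q θ| ≤ MQ) (hΔbd : ∀ θ, |Δ θ| ≤ MΔ) (t : ℝ) :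
    Integrable (fun θ => Real.exp (-(Q θ + t * Δ θ) / 2) • r θ) π ∧
    HasDerivAt (fun t => ∫ θ, Real.exp (-(Q θ + t * Δ θ) / 2) • r θ ∂π)
      (-(1 / 2 : ℝ) • ∫ θ, (Real.exp (-(Q θ + t * Δ θ) / 2) * Δ θ) • r θ ∂π) t := by
  have hm : ∀ x : ℝ, Measurable (fun θ => Real.exp (-(Q θ + x * Δ θ) / 2)) := by
    intro x; fun_prop
  set C := Real.exp ((MQ + (|t| + 1) * MΔ) / 2) with hC
  have hb : ∀ θ, ∀ x ∈ Metric.ball t 1, Real.exp (-(Q θ + x * Δ θ) / 2) ≤ C :=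
    fun θ x hx => qb_aux_bound _ _ _ _ _ _ (hQbd θ) (hΔbd θ) hx
  have hint : Integrable (fun θ => Real.exp (-(Q θ + t * Δ θ) / 2) • r θ) π := by
    refine Integrable.of_bound ((hm t).aestronglyMeasurable.smul hr) (C * Mr)
      (Filter.Eventually.of_forall fun θ => ?_)
    rw [norm_smul, Real.norm_eq_abs, Real.abs_exp]
    exact mul_le_mul (hb θ t (Metric.mem_ball_self one_pos)) (hrbd θ) (norm_nonneg _)
      (Real.exp_pos _).le
  refine ⟨hint, ?_⟩
  have key := (hasDerivAt_integral_of_dominated_loc_of_deriv_le (μ := π) (x₀ := t)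
    (F := fun x θ => Real.exp (-(Q θ + x * Δ θ) / 2) • r θ)
    (F' := fun x θ => (-(1 / 2 : ℝ)) • ((Real.exp (-(Q θ + x * Δ θ) / 2) * Δ θ) • r θ))
    (bound := fun _ => (1 / 2) * (C * MΔ * Mr))
    (Metric.ball_mem_nhds t one_pos)
    (Filter.Eventually.of_forall fun x => (hm x).aestronglyMeasurable.smul hr)
    hint
    ((((hm t).mul hΔmeas).aestronglyMeasurable.smul hr).const_smul _)
    (Filter.Eventually.of_forall fun θ x hx => ?_)
    (integrable_const _)
    (Filter.Eventually.of_forall fun θ x hx => ?_)).2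
  · rwa [integral_smul] at key
  · rw [norm_smul, norm_smul, norm_mul, Real.norm_eq_abs, Real.norm_eq_abs, Real.norm_eq_abs,
      Real.abs_exp, abs_neg, abs_of_pos (by norm_num : (0 : ℝ) < 1 / 2)]
    have hM : 0 ≤ MΔ := (abs_nonneg _).trans (hΔbd θ)
    have hCp : 0 ≤ C := (Real.exp_pos _).le
    gcongr
    · exact hb θ x hx
    · exact hΔbd θ
    · exact hrbd θ
  · have h1 : HasDerivAt (fun x : ℝ => -(Q θ + x * Δ θ) / 2) (-(1 * Δ θ) / 2) x :=
      ((((hasDerivAt_id x).mul_const (Δ θ)).const_add (Q θ)).neg).div_const 2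
    have h2 := h1.exp.smul_const (r θ)
    convert h2 using 1
    rw [smul_smul]
    congr 1
    ring

/-- Derivative of the quasi-Bayes posterior mean along the path of objectives
`Q + t Δ`: it equals `-1/2` times the posterior covariance of `r` and `Δ`. -/
theorem quasiBayes_posterior_mean_derivative
    {Θ : Type*} [MeasurableSpace Θ] (π : Measure Θ) [IsProbabilityMeasure π]
    (p : ℕ) (hp : 0 < p)
    (r : Θ → EuclideanSpace ℝ (Fin p)) (hrmeas : Measurable r)
    (Mr : ℝ) (hrbd : ∀ θ, ‖r θ‖ ≤ Mr)
    (Q Δ : Θ → ℝ) (hQmeas : Measurable Q) (hΔmeas : Measurable Δ)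
    (MQ MΔ : ℝ) (hQbd : ∀ θ, |Q θ| ≤ MQ) (hΔbd : ∀ θ, |Δ θ| ≤ MΔ)
    (Z : ℝ → ℝ) (hZ : ∀ t, Z t = ∫ θ, Real.exp (-(Q θ + t * Δ θ) / 2) ∂π)
    (Er : ℝ → EuclideanSpace ℝ (Fin p))
    (hEr : ∀ t, Er t = (Z t)⁻¹ • ∫ θ, Real.exp (-(Q θ + t * Δ θ) / 2) • r θ ∂π)
    (EΔr : ℝ → EuclideanSpace ℝ (Fin p))
    (hEΔr : ∀ t, EΔr t =
      (Z t)⁻¹ • ∫ θ, (Real.exp (-(Q θ + t * Δ θ) / 2) * Δ θ) • r θ ∂π)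
    (EΔ : ℝ → ℝ)
    (hEΔ : ∀ t, EΔ t = (Z t)⁻¹ * ∫ θ, Real.exp (-(Q θ + t * Δ θ) / 2) * Δ θ ∂π) :
    ∀ t : ℝ, HasDerivAt Er (-(1 / 2 : ℝ) • (EΔr t - EΔ t • Er t)) t := by
  intro t
  have hN := (qb_aux_deriv π r hrmeas.aestronglyMeasurable Mr hrbd Q Δ hQmeas hΔmeas MQ MΔ
    hQbd hΔbd t).2
  obtain ⟨hi, hD⟩ := qb_aux_deriv π (fun _ => (1 : ℝ)) aestronglyMeasurable_const 1 (by simp)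
    Q Δ hQmeas hΔmeas MQ MΔ hQbd hΔbd t
  simp only [smul_eq_mul, mul_one] at hi hD
  have hZf : Z = fun t => ∫ θ, Real.exp (-(Q θ + t * Δ θ) / 2) ∂π := funext hZ
  have hZpos : 0 < Z t := by
    rw [hZ]; exact integral_exp_pos hi
  rw [← hZf] at hD
  have hE : Er = fun t => (Z t)⁻¹ • ∫ θ, Real.exp (-(Q θ + t * Δ θ) / 2) • r θ ∂π := funext hEr
  have key := (hD.inv hZpos.ne').smul hN
  rw [hE]
  refine HasDerivAt.congr_deriv key ?_
  rw [hEΔr, hEΔ]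
  simp only [Pi.inv_apply]
  match_scalars <;> field_simp
end

section
/- Let Θ be a nonempty finite set, k and p positive natural numbers, and for each θ ∈ Θ let Σ(θ) be a symmetric positive-definite real k×k matrix. For g : Θ → ℝ^k define Q(θ | g) = g(θ)ᵀ Σ(θ)⁻¹ g(θ). Let π : Θ → ℝ satisfy π(θ) > 0 for all θ and ∑_θ π(θ) = 1, with π̲ = min_θ π(θ), and let r : Θ → EuclideanSpace ℝ (Fin p) satisfy ‖r(θ)‖ ≤ r̄ for all θ. Define the quasi-Bayes estimator δ(g) = (∑_θ exp(−Q(θ|g)/2)·π(θ)·r(θ)) / (∑_θ exp(−Q(θ|g)/2)·π(θ)). Then for every C > 0 and every θ₀ ∈ Θ, for all g, g' with Q(θ₀ | g) ≤ C and Q(θ₀ | g') ≤ C, one has ‖δ(g) − δ(g')‖ ≤ r̄ · √p · exp(C/2 − 1) · π̲^{−1} · max_θ √(Q(θ | g − g')). -/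
open scoped BigOperators Matrix

lemma qb_exp_lo (x : ℝ) : 0.4965 * (0.7 + x^2/2) * Real.exp 1 ≤ Real.exp (x^2/2) := by
  have h1 : (0.4965:ℝ) ≤ Real.exp (-0.7) := by
    have h := Real.exp_bound' (x := 0.7) (by norm_num) (by norm_num) (n := 8) (by norm_num)
    rw [Real.exp_neg, le_inv_comm₀ (by norm_num) (Real.exp_pos _)]
    refine h.trans ?_
    norm_num [Finset.sum_range_succ, Nat.factorial]
  have h2 := Real.add_one_le_exp (x^2/2 - 0.3)
  have h3 : Real.exp (x^2/2) = Real.exp (-0.7) * Real.exp (x^2/2-0.3) * Real.exp 1 := by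
    rw [← Real.exp_add, ← Real.exp_add]; congr 1; ring
  rw [h3]
  gcongr
  linarith

/-- core polynomial inequality -/
lemma qb_poly (x L : ℝ) :
    x + x^2*(5/14) + 0.7 + L*(5/7) ≤ 0.4965 * (0.7 + x^2/2) * (4 + L^2) := by
  set G := 0.4965 * (4 + L^2) with hG
  have hA : 0 < G/2 - 5/14 := by rw [hG]; nlinarith [sq_nonneg L, sq_nonneg (L^2)]
  have hd : 1 ≤ 4 * (G/2 - 5/14) * (0.7*G - 0.7 - L*(5/7)) := by
    rw [hG]
    nlinarith [sq_nonneg (L^2 - 1.0276*L + 0.18), sq_nonneg (L - 0.78)]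
  have h1 : 0 ≤ (4 * (G/2 - 5/14)) * ((G/2 - 5/14) * x^2 - x + (0.7*G - 0.7 - L*(5/7))) := by
    nlinarith [sq_nonneg (2*(G/2-5/14)*x - 1)]
  have h2 := nonneg_of_mul_nonneg_right h1 (by linarith)
  have h3 : 0.4965 * (0.7 + x^2/2) * (4 + L^2) = (0.7 + x^2/2) * G := by rw [hG]; ring
  rw [h3]
  linarith

lemma qb_core (x y : ℝ) : Real.exp 1 * (x+y) * Real.exp ((y^2-x^2)/2)
    ≤ Real.exp (x^2/2) * (Real.exp ((y^2-x^2)/2) + 1)^2 := by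
  set L := (y^2-x^2)/2 with hL
  have hc : 4 + L^2 ≤ Real.exp L + 2 + Real.exp (-L) := by
    have h0 : |L/2| ≤ |Real.sinh (L/2)| := by
      rw [Real.abs_sinh]; exact Real.self_le_sinh_iff.2 (abs_nonneg _)
    have h := sq_le_sq.2 h0
    rw [Real.sinh_eq] at h
    have e1 : Real.exp L = Real.exp (L/2)^2 := by rw [← Real.exp_nat_mul]; congr 1; push_cast; ring
    have e2 : Real.exp (-L) = Real.exp (-(L/2))^2 := by
      rw [← Real.exp_nat_mul]; congr 1; push_cast; ring
    have e3 : Real.exp (L/2) * Real.exp (-(L/2)) = 1 := by rw [← Real.exp_add]; simp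
    rw [e1, e2]
    nlinarith
  have hy : y ≤ x^2*(5/14) + 0.7 + L*(5/7) := by
    rw [hL]; nlinarith [sq_nonneg (y-1.4)]
  have hp := qb_poly x L
  have he := qb_exp_lo x
  have h4 : Real.exp 1 * (x+y) ≤ Real.exp (x^2/2) * (Real.exp L + 2 + Real.exp (-L)) := by
    calc Real.exp 1 * (x+y) ≤ Real.exp 1 * (0.4965 * (0.7 + x^2/2) * (4 + L^2)) := by
          gcongr; linarith
      _ = (0.4965 * (0.7 + x^2/2) * Real.exp 1) * (4 + L^2) := by ring
      _ ≤ _ := by gcongr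
  have h5 : Real.exp (-L) * Real.exp L = 1 := by rw [← Real.exp_add]; simp
  calc _ ≤ (Real.exp (x^2/2) * (Real.exp L + 2 + Real.exp (-L))) * Real.exp L := by gcongr
    _ = Real.exp (x^2/2) * (Real.exp L ^2 + 2 * Real.exp L + Real.exp (-L) * Real.exp L) := by ring
    _ = _ := by rw [h5]; ring

lemma qb_core2 (x y : ℝ) (hD : 3 ≤ Real.exp ((y^2-x^2)/2)) : 2 * (Real.exp 1 * (x+y))
    ≤ Real.exp (x^2/2) * (Real.exp ((y^2-x^2)/2) + 7.29) := by
  set L := (y^2-x^2)/2 with hL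
  set D := Real.exp L with hDD
  have hy : y ≤ x^2*(5/14) + 0.7 + L*(5/7) := by
    rw [hL]; nlinarith [sq_nonneg (y-1.4)]
  have hl : ∀ K : ℝ, 0 < K → L ≤ Real.log K + (D/K - 1) := by
    intro K hK
    have h3 : L = Real.log D := by rw [hDD, Real.log_exp]
    have h4 : Real.log (D/K) ≤ D/K - 1 := Real.log_le_sub_one_of_pos (by positivity)
    rw [Real.log_div (by positivity) hK.ne'] at h4
    linarith
  have hl1 : Real.log 3.5 ≤ 1.2528 := by
    rw [Real.log_le_iff_le_exp (by norm_num)]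
    have h := Real.sum_le_exp_of_nonneg (x := 1.2528) (by norm_num) 14
    refine le_trans ?_ h
    norm_num [Finset.sum_range_succ, Nat.factorial]
  have hl2 : Real.log 5 ≤ 1.61 := by
    rw [Real.log_le_iff_le_exp (by norm_num)]
    have h := Real.sum_le_exp_of_nonneg (x := 1.61) (by norm_num) 14
    refine le_trans ?_ h
    norm_num [Finset.sum_range_succ, Nat.factorial]
  have he := qb_exp_lo x
  have hp : 2*(x + x^2*(5/14) + 0.7 + L*(5/7)) ≤ 0.4965 * (0.7 + x^2/2) * (D + 7.29) := by
    rcases le_total D 5 with h5 | h5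
    · have h6 := hl 3.5 (by norm_num)
      have h7 : L ≤ 0.2528 + D*(2/7) := by
        have : D / 3.5 = D*(2/7) := by norm_num [div_eq_mul_inv]
        linarith
      have k1 : 0 ≤ 1.84*x^2 - 2*x + 0.585 := by nlinarith [sq_nonneg (x - 0.54)]
      have k2 : 0 ≤ 2.337*x^2 - 2*x + 0.465 := by nlinarith [sq_nonneg (x - 0.43)]
      nlinarith [mul_nonneg (sub_nonneg.2 hD) k2, mul_nonneg (sub_nonneg.2 h5) k1]
    · have h6 := hl 5 (by norm_num)
      nlinarith [sq_nonneg (x - 0.43), mul_nonneg (sub_nonneg.2 h5) (sq_nonneg x)]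
  calc 2 * (Real.exp 1 * (x+y)) = Real.exp 1 * (2*(x+y)) := by ring
   _ ≤ Real.exp 1 * (0.4965 * (0.7 + x^2/2) * (D+7.29)) := by
          apply mul_le_mul_of_nonneg_left _ (Real.exp_pos 1).le
          linarith
      _ = (0.4965 * (0.7 + x^2/2) * Real.exp 1) * (D+7.29) := by ring
      _ ≤ _ := mul_le_mul_of_nonneg_right he (by linarith)

lemma qb_core3 (x y : ℝ) (hx : 0 ≤ x) (hy : 0 ≤ y) (hD : Real.exp ((y^2-x^2)/2) ≤ 1) :
   Real.exp 1 * (x+y) ≤ Real.exp (x^2/2) * 4 := by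
  have h1 : y ≤ x := by
    rw [Real.exp_le_one_iff] at hD
    nlinarith
  have he := qb_exp_lo x
  have e0 := Real.exp_pos 1
  have : (x+y) ≤ 0.4965 * (0.7 + x^2/2) * 4 := by nlinarith [sq_nonneg (x-1)]
  nlinarith

lemma qb_alg (a c m D T : ℝ) (ha : 0 < a) (hc : 0 < c) (hac : a + c = 1) (hm : 0 < m)
    (hma : m ≤ a) (hmc : m ≤ c) (hD : 0 < D) (hT : 0 ≤ T)
    (h1 : T * D ≤ (D+1)^2) (h2 : 3 ≤ D → 2 * T ≤ D + 7.29) (h3 : D ≤ 1 → T ≤ 4) :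
    2*a*c*m*D*T ≤ (a*D+c)^2 := by
  obtain rfl : c = 1 - a := by linarith
  rcases le_total D 1 with hD1 | hD1
  · have hT4 := h3 hD1
    have : m * T ≤ 2 := by nlinarith
    have h0 : 0 ≤ 2*a*(1-a)*D := by positivity
    nlinarith [mul_le_mul_of_nonneg_left this h0, sq_nonneg (a*D-(1-a))]
  rcases le_total a (1/2) with h | h
  · rcases le_total D 3 with hD3 | hD3
    · have h0 : 0 ≤ 2*a*(1-a) := by positivity
      have e1 : 2*a*(1-a)*m*D*T ≤ 2*a*(1-a)*a*(D+1)^2 := by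
        calc _ = (2*a*(1-a)) * m * (T*D) := by ring
          _ ≤ _ := by gcongr
      refine e1.trans ?_
      have k0 : 0 ≤ 1 - 8*a^2*(1-a) := by nlinarith [sq_nonneg (1-2*a)]
      have k2 : 0 ≤ (1-2*a)^2*(1+8*a) := by positivity
      have k3 : 0 ≤ (a^2*(1-2*a)) * ((D-1)*(3-D)) :=
        mul_nonneg (mul_nonneg (sq_nonneg _) (by linarith)) (mul_nonneg (by linarith) (by linarith))
      nlinarith [mul_nonneg (sub_nonneg.2 hD3) k0, mul_nonneg (sub_nonneg.2 hD1) k2]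
    · have e1 : 2*a*(1-a)*m*D*T ≤ a*(1-a)*a*D*(D+7.29) := by
        calc _ = (a*(1-a)) * m *D* (2*T) := by ring
          _ ≤ _ := by gcongr; exact h2 hD3
      refine e1.trans ?_
      have e2 : 0 ≤ a * (a*D)^2 + 2*(a*D)*(1-a)+(1-a)^2 - 7.29*a*(1-a)*(a*D) := by
        have k1 : 0 ≤ a * ((a*D)^2 - 5.29*(1-a)*(a*D) + 7*(1-a)^2) := by
          apply mul_nonneg ha.le
          nlinarith [sq_nonneg (a*D - 2.645*(1-a)), sq_nonneg (1-a)]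
        have k2 : 0 ≤ 2*(1-a)^2*(a*(D-3)) :=
          mul_nonneg (by positivity) (mul_nonneg ha.le (by linarith))
        have k3 : 0 ≤ (1-a)^3 := by positivity
        nlinarith
      nlinarith
  · have h0 : 0 ≤ 2*a*(1-a) := by positivity
    have e1 : 2*a*(1-a)*m*D*T ≤ 2*a*(1-a)*(1-a)*(D+1)^2 := by
        calc _ = (2*a*(1-a)) * m * (T*D) := by ring
          _ ≤ _ := by gcongr
    refine e1.trans ?_
    have e2 : (D+1)/2 ≤ a*D+(1-a) := by nlinarith
    have e3 : ((D+1)/2)^2 ≤ (a*D+(1-a))^2 := by gcongr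
    have e4 : 2*a*(1-a)*(1-a) ≤ 1/4 := by nlinarith [sq_nonneg (2*a-1), mul_pos ha hc]
    nlinarith [sq_nonneg (D+1)]

lemma qb_two (a c m x y : ℝ) (ha : 0 < a) (hc : 0 < c) (hac : a + c = 1) (hm : 0 < m)
    (hma : m ≤ a) (hmc : m ≤ c) (hx : 0 ≤ x) (hy : 0 ≤ y) :
    2 * (Real.exp (-x^2/2) * a) * (Real.exp (-y^2/2) * c) * (x+y) *
      (m * Real.exp 1 * Real.exp (-x^2/2)) ≤
    (Real.exp (-x^2/2) * a + Real.exp (-y^2/2) * c)^2 := by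
  have h1 := qb_core x y
  have h2 := qb_core2 x y
  have h3 := qb_core3 x y hx hy
  set D := Real.exp ((y^2-x^2)/2) with hD
  set F := Real.exp (-x^2/2) with hF
  have hE : Real.exp (x^2/2) * F = 1 := by rw [hF, ← Real.exp_add]; simp; ring
  have hFD : F = Real.exp (-y^2/2) * D := by rw [hF, hD, ← Real.exp_add]; congr 1; ring
  set E := Real.exp (x^2/2) with hEE
  have hF0 : 0 < F := Real.exp_pos _
  have hD0 : 0 < D := Real.exp_pos _
  have key := qb_alg a c m D (Real.exp 1 * (x+y) * F) ha hc hac hm hma hmc hD0 (by positivity)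
    (by calc _ = (Real.exp 1 * (x+y) * D) * F := by ring
          _ ≤ (E * (D+1)^2) * F := by gcongr
          _ = (E*F) * (D+1)^2 := by ring
          _ = _ := by rw [hE, one_mul])
    (fun h => by
        calc _ = (2*(Real.exp 1 * (x+y))) * F := by ring
          _ ≤ (E * (D+7.29)) * F := mul_le_mul_of_nonneg_right (h2 h) hF0.le
          _ = (E*F) * (D+7.29) := by ring
          _ = _ := by rw [hE, one_mul])
    (fun h => by
        calc _ ≤ (E * 4) * F := mul_le_mul_of_nonneg_right (h3 h) hF0.le
          _ = (E*F) * 4 := by ring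
          _ = _ := by rw [hE, one_mul])
  set H := Real.exp (-y^2/2)
  calc _ = (2*a*c*m*D*(Real.exp 1 * (x+y) * F)) * H^2 := by
        nth_rewrite 1 [hFD]; ring
    _ ≤ (a*D+c)^2 * H^2 := by gcongr
    _ = _ := by rw [hFD]; ring

lemma qb_three {Θ : Type*} [Fintype Θ] (pj x : Θ → ℝ) (hpj : ∀ θ, 0 < pj θ)
    (hsum : ∑ θ, pj θ = 1) (m : ℝ) (hm : 0 < m) (hm3 : m ≤ 1/3) (hmp : ∀ θ, m ≤ pj θ) (θ₀ : Θ) :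
    (∑ θ, Real.exp (-(x θ)^2/2) * pj θ * (x θ)^2) *
      (m * Real.exp 1 * Real.exp (-(x θ₀)^2/2))^2 ≤ ∑ θ, Real.exp (-(x θ)^2/2) * pj θ := by
  classical
  set e0 := Real.exp (-(x θ₀)^2/2) with he0
  set c := (m * Real.exp 1 * e0)^2 with hc
  have he0p : 0 < e0 := Real.exp_pos _
  have he01 : e0 ≤ 1 := by rw [he0, Real.exp_le_one_iff]; nlinarith [sq_nonneg (x θ₀)]
  have hcp : 0 < c := by positivity
  have ee := Real.exp_one_lt_d9
  have eep := Real.exp_pos 1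
  have hme : m * Real.exp 1 ≤ 0.9061 := by nlinarith
  have hc1 : c ≤ 0.8333 := by
    have : m * Real.exp 1 * e0 ≤ 0.9061 := by
      have : m * Real.exp 1 * e0 ≤ m * Real.exp 1 * 1 := by gcongr
      linarith
    have h0 : 0 ≤ m * Real.exp 1 * e0 := by positivity
    rw [hc]; nlinarith
  have hterm : ∀ q : ℝ, Real.exp (-q/2) * (c*q - 1) ≤ 2*c*Real.exp (-1 - 1/(2*c)) := by
    intro q
    have h := Real.add_one_le_exp (q/2 - 1/(2*c) - 1)
    have h2 : Real.exp (-1 - 1/(2*c)) = Real.exp (-q/2) * Real.exp (q/2 - 1/(2*c) - 1) := by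
      rw [← Real.exp_add]; congr 1; ring
    rw [h2]
    have h3 : c*q - 1 = 2*c*(q/2 - 1/(2*c)) := by field_simp
    rw [h3]
    have h4 : q/2 - 1/(2*c) ≤ Real.exp (q/2 - 1/(2*c) - 1) := by linarith
    calc _ = (Real.exp (-q/2) * (2*c)) * (q/2 - 1/(2*c)) := by ring
      _ ≤ (Real.exp (-q/2) * (2*c)) * Real.exp (q/2 - 1/(2*c) - 1) := by gcongr
      _ = _ := by ring
  set K := 2*c*Real.exp (-1 - 1/(2*c)) with hK
  have hK0 : 0 < K := by positivity
  have hKle : K ≤ 2 * m^2 * Real.exp 1 * e0 * 0.549 := by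
    have h1 : Real.exp (-1 - 1/(2*c)) ≤ (Real.exp 1)⁻¹ * 0.549 := by
      have h2 : Real.exp (-1 - 1/(2*c)) = (Real.exp 1)⁻¹ * Real.exp (-(1/(2*c))) := by
        rw [← Real.exp_neg, ← Real.exp_add]; congr 1
      rw [h2]
      have h3 : (0.6:ℝ) ≤ 1/(2*c) := by rw [le_div_iff₀ (by positivity)]; linarith
      have h4 : Real.exp (-(1/(2*c))) ≤ Real.exp (-0.6) := Real.exp_le_exp.2 (by linarith)
      have h5 : Real.exp (-0.6) ≤ 0.549 := by
        rw [Real.exp_neg, inv_le_comm₀ (Real.exp_pos _) (by norm_num)]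
        have h := Real.sum_le_exp_of_nonneg (x := 0.6) (by norm_num) 8
        refine le_trans ?_ h
        norm_num [Finset.sum_range_succ, Nat.factorial]
      gcongr
      exact h4.trans h5
    calc K ≤ 2*c*((Real.exp 1)⁻¹ * 0.549) := by rw [hK]; gcongr
      _ = 2 * m^2 * Real.exp 1 * (e0*e0) * 0.549 := by rw [hc]; field_simp
      _ ≤ 2 * m^2 * Real.exp 1 * (e0*1) * 0.549 := by gcongr
      _ = _ := by ring
  have hx0 : c * (x θ₀)^2 ≤ 0.3021 := by
    have h := Real.add_one_le_exp ((x θ₀)^2 - 1)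
    have h2 : e0^2 * Real.exp ((x θ₀)^2 - 1) * Real.exp 1 = 1 := by
      rw [he0, ← Real.exp_nat_mul, ← Real.exp_add, ← Real.exp_add, Real.exp_eq_one_iff]
      push_cast; ring
    have h3 : e0^2 * (x θ₀)^2 * Real.exp 1 ≤ 1 := by
      refine le_trans ?_ h2.le; gcongr; linarith
    calc c * (x θ₀)^2 = (m^2 * Real.exp 1) * (e0^2 * (x θ₀)^2 * Real.exp 1) := by rw [hc]; ring
      _ ≤ (m^2 * Real.exp 1) * 1 := by gcongr
      _ = m * (m * Real.exp 1) := by ring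
      _ ≤ (1/3) * 0.9061 := by gcongr
      _ ≤ _ := by norm_num
  -- split off θ₀
  have hrest : ∑ θ ∈ Finset.univ.erase θ₀, Real.exp (-(x θ)^2/2) * pj θ * (c * (x θ)^2 - 1)
      ≤ (1 - m) * K := by
    calc _ ≤ ∑ θ ∈ Finset.univ.erase θ₀, pj θ * K := by
          apply Finset.sum_le_sum
          intro θ _
          have := mul_le_mul_of_nonneg_left (hterm ((x θ)^2)) (hpj θ).le
          linarith
      _ = (1 - pj θ₀) * K := by
          rw [← Finset.sum_mul, ← hsum, ← Finset.add_sum_erase _ _ (Finset.mem_univ θ₀)]; ring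
      _ ≤ _ := by gcongr; exact hmp θ₀
  have hfirst : e0 * pj θ₀ * (c * (x θ₀)^2 - 1) ≤ - (e0 * m * 0.6979) := by
    have h1 := hmp θ₀
    have h2 : 0 ≤ 1 - c * (x θ₀)^2 - 0.6979 := by linarith
    have h3 : e0 * m * 0.6979 ≤ e0 * pj θ₀ * (1 - c * (x θ₀)^2) := by
      have := (hpj θ₀).le
      gcongr; linarith
    linarith
  have hfin : (1-m)*K ≤ e0 * m * 0.6979 := by
    calc (1-m)*K ≤ (1-m) * (2 * m^2 * Real.exp 1 * e0 * 0.549) := by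
          apply mul_le_mul_of_nonneg_left hKle; linarith
      _ = (e0 * m) * (((1-m)*m) * Real.exp 1 * 1.098) := by ring
      _ ≤ (e0 * m) * ((2/9) * 2.7183 * 1.098) := by
          have : (1-m)*m ≤ 2/9 := by nlinarith
          gcongr
          linarith
      _ ≤ _ := by apply mul_le_mul_of_nonneg_left _ (by positivity); norm_num
  have htot : ∑ θ, Real.exp (-(x θ)^2/2) * pj θ * (c * (x θ)^2 - 1) ≤ 0 := by
    rw [← Finset.add_sum_erase _ _ (Finset.mem_univ θ₀)]
    linarith
  have : ∑ θ, Real.exp (-(x θ)^2/2) * pj θ * (c * (x θ)^2 - 1)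
     = (∑ θ, Real.exp (-(x θ)^2/2) * pj θ * (x θ)^2) * c - ∑ θ, Real.exp (-(x θ)^2/2) * pj θ := by
    rw [Finset.sum_mul, ← Finset.sum_sub_distrib]
    exact Finset.sum_congr rfl fun _ _ => by ring
  linarith

/-- Cauchy-Schwarz form of the covariance bound. -/
lemma qb_cov {Θ : Type*} [Fintype Θ] (u b f : Θ → ℝ) (hu : ∀ θ, 0 < u θ) (R : ℝ)
    (hf : ∀ θ, |f θ| ≤ R) :
    ((∑ θ, u θ * b θ * f θ) * (∑ θ, u θ) - (∑ θ, u θ * f θ) * (∑ θ, u θ * b θ))^2 ≤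
      R^2 * (∑ θ, u θ)^3 * (∑ θ, u θ * (b θ)^2) := by
  set Z := ∑ θ, u θ with hZ
  set N := ∑ θ, u θ * f θ with hN
  have hZ0 : 0 ≤ Z := Finset.sum_nonneg fun θ _ => (hu θ).le
  have h1 : (∑ θ, u θ * b θ * f θ) * Z - N * (∑ θ, u θ * b θ)
      = ∑ θ, (u θ * b θ) * (Z * f θ - N) := by
    rw [Finset.sum_mul, Finset.mul_sum, ← Finset.sum_sub_distrib]
    exact Finset.sum_congr rfl fun _ _ => by ring
  rw [h1]
  have h2 := Finset.sum_sq_le_sum_mul_sum_of_sq_le_mul Finset.univ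
    (r := fun θ => (u θ * b θ) * (Z * f θ - N)) (f := fun θ => u θ * (b θ)^2)
    (g := fun θ => u θ * (Z * f θ - N)^2)
    (fun θ _ => mul_nonneg (hu θ).le (sq_nonneg _)) (fun θ _ => mul_nonneg (hu θ).le (sq_nonneg _))
    (fun θ _ => le_of_eq (by ring))
  refine h2.trans ?_
  have h3 : ∑ θ, u θ * (Z * f θ - N)^2 = Z^2 * (∑ θ, u θ * (f θ)^2) - Z * N^2 := by
    have : ∑ θ, u θ * (Z * f θ - N)^2
      = Z^2 * (∑ θ, u θ * (f θ)^2) - 2 * Z * N * (∑ θ, u θ * f θ) + N^2 * ∑ θ, u θ := by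
      clear_value N Z
      rw [Finset.mul_sum, Finset.mul_sum, Finset.mul_sum, ← Finset.sum_sub_distrib,
        ← Finset.sum_add_distrib]
      exact Finset.sum_congr rfl fun _ _ => by ring
    rw [this, ← hN, ← hZ]; ring
  have h4 : ∑ θ, u θ * (f θ)^2 ≤ Z * R^2 := by
    rw [hZ, Finset.sum_mul]
    apply Finset.sum_le_sum
    intro θ _
    have := sq_le_sq' (by linarith [neg_abs_le (f θ), hf θ]) (le_trans (le_abs_self _) (hf θ))
    exact mul_le_mul_of_nonneg_left this (hu θ).le
  have h5 : ∑ θ, u θ * (Z * f θ - N)^2 ≤ R^2 * Z^3 := by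
    rw [h3]
    nlinarith [mul_le_mul_of_nonneg_left h4 (sq_nonneg Z), mul_nonneg hZ0 (sq_nonneg N)]
  have h6 : 0 ≤ ∑ θ, u θ * (b θ)^2 :=
    Finset.sum_nonneg fun θ _ => mul_nonneg (hu θ).le (sq_nonneg _)
  calc _ ≤ (∑ θ, u θ * (b θ)^2) * (R^2 * Z^3) := by gcongr
    _ = _ := by ring

lemma qb_pair (u v b b' f f' R M x y W : ℝ) (hu : 0 < u) (hv : 0 < v) (hM : 0 ≤ M) (hW : 0 ≤ W)
    (hx : 0 ≤ x) (hy : 0 ≤ y)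
    (hb : |b| ≤ x * M) (hb' : |b'| ≤ y * M) (hf : |f| ≤ R) (hf' : |f'| ≤ R)
    (h : 2 * u * v * (x+y) * W ≤ (u+v)^2) :
    |(u*b*f + v*b'*f') * (u+v) - (u*f+v*f') * (u*b+v*b')| * W ≤ R * M * (u+v)^2 := by
  have h1 : (u*b*f + v*b'*f') * (u+v) - (u*f+v*f') * (u*b+v*b') = u*v*((b-b')*(f-f')) := by ring
  have hR : 0 ≤ R := (abs_nonneg _).trans hf
  have h2 : |b-b'| ≤ (x+y)*M := by have := abs_sub b b'; linarith
  have h3 : |f-f'| ≤ 2*R := by have := abs_sub f f'; linarith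
  rw [h1, abs_mul, abs_of_pos (mul_pos hu hv), abs_mul]
  calc _ ≤ u*v*(((x+y)*M)*(2*R))*W := by gcongr
    _ = R*M*(2 * u * v * (x+y) * W) := by ring
    _ ≤ _ := by gcongr

lemma qb_bound {Θ : Type*} [Fintype Θ] (pj x b f : Θ → ℝ) (hpj : ∀ θ, 0 < pj θ)
    (hsum : ∑ θ, pj θ = 1) (m : ℝ) (hm : 0 < m) (hmp : ∀ θ, m ≤ pj θ) (θ₀ : Θ)
    (R M : ℝ) (hM : 0 ≤ M) (hx : ∀ θ, 0 ≤ x θ) (hb : ∀ θ, |b θ| ≤ x θ * M) (hf : ∀ θ, |f θ| ≤ R)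
    (u : Θ → ℝ) (hu : ∀ θ, u θ = Real.exp (-(x θ)^2/2) * pj θ) :
    |(∑ θ, u θ * b θ * f θ) * (∑ θ, u θ) - (∑ θ, u θ * f θ) * (∑ θ, u θ * b θ)| *
      (m * Real.exp 1 * Real.exp (-(x θ₀)^2/2)) ≤ R * M * (∑ θ, u θ)^2 := by
  classical
  have hR : 0 ≤ R := (abs_nonneg _).trans (hf θ₀)
  have hu0 : ∀ θ, 0 < u θ := fun θ => by rw [hu]; exact mul_pos (Real.exp_pos _) (hpj θ)
  have hW : 0 < m * Real.exp 1 * Real.exp (-(x θ₀)^2/2) := by positivity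
  by_cases h3 : 3 ≤ Fintype.card Θ
  · have hm3 : m ≤ 1/3 := by
      have h1 : (Fintype.card Θ : ℝ) * m ≤ 1 := by
        rw [← hsum, ← nsmul_eq_mul, ← Finset.card_univ]
        exact Finset.card_nsmul_le_sum _ _ _ fun θ _ => hmp θ
      have h2 : (3:ℝ) ≤ Fintype.card Θ := by exact_mod_cast h3
      nlinarith
    have k1 := qb_three pj x hpj hsum m hm hm3 hmp θ₀
    have k2 := qb_cov u b f hu0 R hf
    simp only [← hu] at k1
    set Z := ∑ θ, u θ with hZ
    have hZ0 : 0 ≤ Z := Finset.sum_nonneg fun θ _ => (hu0 θ).le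
    set W := m * Real.exp 1 * Real.exp (-(x θ₀)^2/2)
    have k3 : ∑ θ, u θ * (b θ)^2 ≤ M^2 * ∑ θ, u θ * (x θ)^2 := by
      rw [Finset.mul_sum]
      apply Finset.sum_le_sum
      intro θ _
      have h1 : (b θ)^2 ≤ (x θ * M)^2 := sq_le_sq.2 ((hb θ).trans (le_abs_self _))
      have := mul_le_mul_of_nonneg_left h1 (hu0 θ).le
      linarith
    refine (sq_le_sq₀ (by positivity) (by positivity)).1 ?_
    rw [mul_pow, sq_abs]
    calc _ ≤ (R^2 * Z^3 * (M^2 * ∑ θ, u θ * (x θ)^2)) * W^2 := by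
          gcongr
          exact k2.trans (by gcongr)
      _ = (R^2*M^2*Z^3) * ((∑ θ, u θ * (x θ)^2) * W^2) := by ring
      _ ≤ (R^2*M^2*Z^3) * Z := by gcongr
      _ = _ := by ring
  · by_cases h2 : Fintype.card Θ = 2
    · obtain ⟨θ₁, hne, huniv⟩ : ∃ θ₁, θ₀ ≠ θ₁ ∧ (Finset.univ : Finset Θ) = {θ₀, θ₁} := by
        obtain ⟨p, q, hpq, h⟩ := Finset.card_eq_two.1 (Finset.card_univ.trans h2)
        have h0 := Finset.mem_univ θ₀
        rw [h] at h0
        simp only [Finset.mem_insert, Finset.mem_singleton] at h0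
        rcases h0 with rfl | rfl
        · exact ⟨q, hpq, h⟩
        · exact ⟨p, hpq.symm, by rw [h, Finset.pair_comm]⟩
      rw [huniv] at hsum ⊢
      rw [Finset.sum_pair hne] at hsum
      simp only [Finset.sum_pair hne]
      apply qb_pair _ _ _ _ _ _ _ _ _ _ _ (hu0 _) (hu0 _) hM hW.le (hx _) (hx _) (hb _) (hb _)
        (hf _) (hf _)
      have := qb_two (pj θ₀) (pj θ₁) m (x θ₀) (x θ₁) (hpj _) (hpj _) hsum hm (hmp _) (hmp _)
        (hx _) (hx _)
      rw [hu, hu]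
      exact this
    · have h1 : Fintype.card Θ ≤ 1 := by omega
      have hs := Fintype.card_le_one_iff_subsingleton.1 h1
      have huniv : (Finset.univ : Finset Θ) = {θ₀} := by
        ext θ; simp [Subsingleton.elim θ θ₀]
      rw [huniv]
      simp only [Finset.sum_singleton]
      have : u θ₀ * b θ₀ * f θ₀ * u θ₀ - u θ₀ * f θ₀ * (u θ₀ * b θ₀) = 0 := by ring
      rw [this]
      simp
      positivity

lemma qb_quad {k : ℕ} (S : Matrix (Fin k) (Fin k) ℝ) (hS : S.PosDef) (g g' : Fin k → ℝ) :
    ∃ B : ℝ, B^2 ≤ (g' ⬝ᵥ S⁻¹.mulVec g') * ((g-g') ⬝ᵥ S⁻¹.mulVec (g-g')) ∧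
      g ⬝ᵥ S⁻¹.mulVec g = g' ⬝ᵥ S⁻¹.mulVec g' + 2 * B + (g-g') ⬝ᵥ S⁻¹.mulVec (g-g') ∧
      0 ≤ g' ⬝ᵥ S⁻¹.mulVec g' ∧ 0 ≤ (g-g') ⬝ᵥ S⁻¹.mulVec (g-g') := by
  have hnn : ∀ v : Fin k → ℝ, 0 ≤ v ⬝ᵥ S⁻¹.mulVec v := fun v => by
    have := hS.inv.posSemidef.dotProduct_mulVec_nonneg v
    simpa using this
  set d := g - g' with hd
  have hg : g = g' + d := by rw [hd]; abel
  have hexp : ∀ t : ℝ, (g' + t • d) ⬝ᵥ S⁻¹.mulVec (g' + t • d) =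
      (d ⬝ᵥ S⁻¹.mulVec d) * (t * t) + (g' ⬝ᵥ S⁻¹.mulVec d + d ⬝ᵥ S⁻¹.mulVec g') * t
        + g' ⬝ᵥ S⁻¹.mulVec g' := by
    intro t
    simp only [Matrix.mulVec_add, Matrix.mulVec_smul, add_dotProduct, dotProduct_add,
      smul_dotProduct, dotProduct_smul, smul_eq_mul]
    ring
  refine ⟨(g' ⬝ᵥ S⁻¹.mulVec d + d ⬝ᵥ S⁻¹.mulVec g') / 2, ?_, ?_, hnn _, hnn _⟩
  · have := discrim_le_zero (fun t => (hexp t) ▸ hnn _)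
    rw [discrim] at this
    nlinarith
  · have := hexp 1
    rw [one_smul, ← hg] at this
    rw [this]; ring

lemma qb_scalar {Θ : Type*} [Fintype Θ] (pj A B D f : Θ → ℝ) (hpj : ∀ θ, 0 < pj θ)
    (hsum : ∑ θ, pj θ = 1) (m : ℝ) (hm : 0 < m) (hmp : ∀ θ, m ≤ pj θ) (θ₀ : Θ)
    (R M C : ℝ) (hM : 0 ≤ M) (hA : ∀ θ, 0 ≤ A θ) (hD : ∀ θ, 0 ≤ D θ)
    (hB : ∀ θ, (B θ)^2 ≤ A θ * D θ) (hDM : ∀ θ, √(D θ) ≤ M) (hf : ∀ θ, |f θ| ≤ R)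
    (h0 : A θ₀ ≤ C) (h1 : A θ₀ + 2 * B θ₀ + D θ₀ ≤ C) :
    |(∑ θ, Real.exp (-(A θ + 2 * B θ + D θ)/2) * pj θ)⁻¹ *
        (∑ θ, (Real.exp (-(A θ + 2 * B θ + D θ)/2) * pj θ) * f θ) -
      (∑ θ, Real.exp (-(A θ)/2) * pj θ)⁻¹ * (∑ θ, (Real.exp (-(A θ)/2) * pj θ) * f θ)| ≤
    R * Real.exp (C/2-1) * m⁻¹ * M := by
  have hR : 0 ≤ R := (abs_nonneg _).trans (hf θ₀)
  set q : Θ → ℝ → ℝ := fun θ t => A θ + 2 * B θ * t + D θ * t^2 with hq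
  set u : Θ → ℝ → ℝ := fun θ t => Real.exp (-(q θ t)/2) * pj θ with hu
  have hu0 : ∀ θ t, 0 < u θ t := fun θ t => mul_pos (Real.exp_pos _) (hpj θ)
  have hZ0 : ∀ t, 0 < ∑ θ, u θ t := fun t => Finset.sum_pos (fun θ _ => hu0 θ t) ⟨θ₀, Finset.mem_univ _⟩
  have hcs : ∀ θ t, (B θ + D θ * t)^2 ≤ q θ t * D θ := by
    intro θ t; simp only [hq]; nlinarith [hB θ]
  have hq0 : ∀ θ t, 0 ≤ q θ t := by
    intro θ t
    rcases (hD θ).eq_or_lt with h | h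
    · have : B θ = 0 := by have := hB θ; rw [← h, mul_zero] at this; nlinarith [sq_nonneg (B θ)]
      simp only [hq]; rw [← h, this]; simpa using hA θ
    · exact nonneg_of_mul_nonneg_left ((sq_nonneg _).trans (hcs θ t)) h
  have hud : ∀ θ t, HasDerivAt (u θ) (-(u θ t * (B θ + D θ * t))) t := by
    intro θ t
    have h1 : HasDerivAt (q θ) (2 * B θ * 1 + D θ * (2 * t)) t := by
      have e1 := ((hasDerivAt_id t).const_mul (2 * B θ)).const_add (A θ)
      have e2 := (hasDerivAt_pow 2 t).const_mul (D θ)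
      have := e1.add e2
      refine HasDerivAt.congr_deriv (f := q θ) this ?_
      simp
    have h2 := ((h1.neg.div_const 2).exp).mul_const (pj θ)
    refine HasDerivAt.congr_deriv (f := u θ) h2 ?_
    simp only [hu, Pi.neg_apply]
    ring
  set φ : ℝ → ℝ := fun t => (∑ θ, u θ t * f θ) / (∑ θ, u θ t) with hφ
  have hφd : ∀ t, HasDerivAt φ (((∑ θ, -(u θ t * (B θ + D θ * t)) * f θ) * (∑ θ, u θ t) -
      (∑ θ, u θ t * f θ) * (∑ θ, -(u θ t * (B θ + D θ * t)))) / (∑ θ, u θ t)^2) t := by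
    intro t
    have d1 : HasDerivAt (fun t => ∑ θ, u θ t * f θ) (∑ θ, -(u θ t * (B θ + D θ * t)) * f θ) t :=
      HasDerivAt.fun_sum fun θ _ => (hud θ t).mul_const (f θ)
    have d2 : HasDerivAt (fun t => ∑ θ, u θ t) (∑ θ, -(u θ t * (B θ + D θ * t))) t :=
      HasDerivAt.fun_sum fun θ _ => hud θ t
    exact d1.fun_div d2 (hZ0 t).ne'
  have main := norm_image_sub_le_of_norm_deriv_le_segment_01' (f := φ)
    (C := R * Real.exp (C/2-1) * m⁻¹ * M)
    (fun t _ => (hφd t).hasDerivWithinAt) (by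
      intro t ht
      have k := qb_bound pj (fun θ => √(q θ t)) (fun θ => B θ + D θ * t) f hpj hsum m hm hmp θ₀ R M hM
        (fun θ => Real.sqrt_nonneg _) (fun θ => by
          calc |B θ + D θ * t| ≤ √(q θ t * D θ) := Real.abs_le_sqrt (hcs θ t)
            _ = √(q θ t) * √(D θ) := Real.sqrt_mul (hq0 θ t) _
            _ ≤ _ := by gcongr; exact hDM θ) hf (fun θ => u θ t)
        (fun θ => by simp only [hu]; rw [Real.sq_sqrt (hq0 θ t)])
      simp only [Real.sq_sqrt (hq0 θ₀ t)] at k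
      have hqC : q θ₀ t ≤ C := by
        simp only [hq]
        nlinarith [mul_nonneg (hD θ₀) (mul_nonneg ht.1 (sub_nonneg.2 ht.2.le)),
          mul_le_mul_of_nonneg_left h1 ht.1, mul_le_mul_of_nonneg_left h0 (sub_nonneg.2 ht.2.le)]
      have hneg : (∑ θ, -(u θ t * (B θ + D θ * t)) * f θ) * (∑ θ, u θ t) -
          (∑ θ, u θ t * f θ) * (∑ θ, -(u θ t * (B θ + D θ * t))) =
          -((∑ θ, u θ t * (B θ + D θ * t) * f θ) * (∑ θ, u θ t) -
          (∑ θ, u θ t * f θ) * (∑ θ, (u θ t * (B θ + D θ * t)))) := by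
        simp only [neg_mul, Finset.sum_neg_distrib]; ring
      rw [hneg, norm_div, norm_neg, Real.norm_eq_abs, norm_pow, Real.norm_eq_abs,
        abs_of_pos (hZ0 t), div_le_iff₀ (pow_pos (hZ0 t) 2)]
      set X := |(∑ θ, u θ t * (B θ + D θ * t) * f θ) * (∑ θ, u θ t) -
          (∑ θ, u θ t * f θ) * (∑ θ, (u θ t * (B θ + D θ * t)))|
      have hexp : 1 ≤ Real.exp 1 * Real.exp (-(q θ₀ t)/2) * Real.exp (C/2-1) := by
        rw [← Real.exp_add, ← Real.exp_add, Real.one_le_exp_iff]; linarith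
      have hX : 0 ≤ X := abs_nonneg _
      calc X = X * 1 := by ring
        _ ≤ X * (Real.exp 1 * Real.exp (-(q θ₀ t)/2) * Real.exp (C/2-1)) := by gcongr
        _ = (X * (m * Real.exp 1 * Real.exp (-(q θ₀ t)/2))) * (Real.exp (C/2-1) * m⁻¹) := by
            field_simp
        _ ≤ (R * M * (∑ θ, u θ t)^2) * (Real.exp (C/2-1) * m⁻¹) := by gcongr
        _ = _ := by ring)
  have e1 : φ 1 = (∑ θ, Real.exp (-(A θ + 2 * B θ + D θ)/2) * pj θ)⁻¹ *
        (∑ θ, (Real.exp (-(A θ + 2 * B θ + D θ)/2) * pj θ) * f θ) := by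
    simp only [hφ, hu, hq, mul_one, one_pow, div_eq_inv_mul (∑ θ, _)]
  have e0 : φ 0 = (∑ θ, Real.exp (-(A θ)/2) * pj θ)⁻¹ *
        (∑ θ, (Real.exp (-(A θ)/2) * pj θ) * f θ) := by
    simp [hφ, hu, hq, div_eq_inv_mul (∑ θ, _)]
  rw [e1, e0] at main
  exact main

/-- In the finite parameter space limit experiment, the quasi-Bayes estimator is
Lipschitz (in the `Σ`-sup norm on moment vectors) on each sublevel set of the
GMM objective at any fixed parameter value. -/
theorem quasiBayes_lipschitz_on_bounded_J
    {Θ : Type*} [Fintype Θ] [Nonempty Θ]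
    (k p : ℕ) (hk : 0 < k) (hp : 0 < p)
    (S : Θ → Matrix (Fin k) (Fin k) ℝ)
    (hSsym : ∀ θ, (S θ).IsSymm) (hSpd : ∀ θ, (S θ).PosDef)
    (Qf : Θ → (Fin k → ℝ) → ℝ)
    (hQf : ∀ θ v, Qf θ v = v ⬝ᵥ (S θ)⁻¹.mulVec v)
    (pj : Θ → ℝ) (hpj : ∀ θ, 0 < pj θ) (hpjsum : ∑ θ, pj θ = 1)
    (πmin : ℝ) (hπmin : πmin = ⨅ θ, pj θ)
    (rbar : ℝ) (r : Θ → EuclideanSpace ℝ (Fin p)) (hr : ∀ θ, ‖r θ‖ ≤ rbar)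
    (δ : (Θ → Fin k → ℝ) → EuclideanSpace ℝ (Fin p))
    (hδ : ∀ g, δ g = (∑ θ, Real.exp (-Qf θ (g θ) / 2) * pj θ)⁻¹ •
      ∑ θ, (Real.exp (-Qf θ (g θ) / 2) * pj θ) • r θ) :
    ∀ C : ℝ, 0 < C → ∀ θ₀ : Θ, ∀ g g' : Θ → Fin k → ℝ,
      Qf θ₀ (g θ₀) ≤ C → Qf θ₀ (g' θ₀) ≤ C →
      ‖δ g - δ g'‖ ≤ rbar * Real.sqrt p * Real.exp (C / 2 - 1) * πmin⁻¹ *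
        ⨆ θ, Real.sqrt (Qf θ (g θ - g' θ)) := by
  intro C hC θ₀ g g' hg hg'
  have hbdd : BddAbove (Set.range fun θ => Real.sqrt (Qf θ (g θ - g' θ))) := (Set.finite_range _).bddAbove
  have hbddb : BddBelow (Set.range pj) := (Set.finite_range _).bddBelow
  have hmp : ∀ θ, πmin ≤ pj θ := fun θ => hπmin ▸ ciInf_le hbddb θ
  have hm : 0 < πmin := by
    obtain ⟨θ, hθ⟩ := exists_eq_ciInf_of_finite (f := pj)
    rw [hπmin, ← hθ]; exact hpj θ
  set M := ⨆ θ, Real.sqrt (Qf θ (g θ - g' θ)) with hMdef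
  have hDM : ∀ θ, Real.sqrt (Qf θ (g θ - g' θ)) ≤ M := fun θ => le_ciSup hbdd θ
  have hM : 0 ≤ M := (Real.sqrt_nonneg _).trans (hDM θ₀)
  have hrb : 0 ≤ rbar := (norm_nonneg _).trans (hr θ₀)
  choose B hB1 hB2 hB3 hB4 using fun θ => qb_quad (S θ) (hSpd θ) (g θ) (g' θ)
  simp only [← hQf] at hB1 hB2 hB3 hB4
  set v := δ g - δ g' with hv
  have key := qb_scalar pj (fun θ => Qf θ (g' θ)) B (fun θ => Qf θ (g θ - g' θ))
    (fun θ => inner ℝ v (r θ)) hpj hpjsum πmin hm hmp θ₀ (‖v‖ * rbar) M C hM hB3 hB4 hB1 hDM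
    (fun θ => (abs_real_inner_le_norm _ _).trans (by gcongr; exact hr θ)) hg'
    (by rw [← hB2]; exact hg)
  simp only [← hB2] at key
  have hin : ∀ h, inner ℝ v (δ h) = (∑ θ, Real.exp (-Qf θ (h θ) / 2) * pj θ)⁻¹ *
      ∑ θ, (Real.exp (-Qf θ (h θ) / 2) * pj θ) * inner ℝ v (r θ) := by
    intro h
    rw [hδ, inner_smul_right, inner_sum]
    simp only [inner_smul_right]
  rw [← hin, ← hin, ← inner_sub_right, ← hv, real_inner_self_eq_norm_sq,
    abs_of_nonneg (sq_nonneg _)] at key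
  have h1 : ‖v‖ ≤ rbar * Real.exp (C/2-1) * πmin⁻¹ * M := by
    rcases (norm_nonneg v).eq_or_lt with h | h
    · rw [← h]; positivity
    · apply le_of_mul_le_mul_left _ h
      linarith
  have hp1 : 1 ≤ Real.sqrt p := Real.one_le_sqrt.2 (by exact_mod_cast hp)
  calc ‖v‖ ≤ rbar * Real.exp (C/2-1) * πmin⁻¹ * M := h1
    _ ≤ (rbar * Real.exp (C/2-1) * πmin⁻¹ * M) * Real.sqrt p :=
        le_mul_of_one_le_right (by positivity) hp1
    _ = _ := by ring
end
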